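/- Suppose m = m_n and p = p_n satisfy m p² = o(1), n² m p² → ∞, n = o(m), and n p / ln(m/n) → ∞ as n → ∞. Then for any function ω = ω_n → ∞ there exists a constant C such that with high probability mod(G(n,m,p)) ≤ C ( ( ln(m/n) / (np) )^{1/2} + n/m + ω m p² ). -/

import Mathlib

open MeasureTheory Filter Topology
open scoped Classical

namespace RIG

variable {V : Type*}

/-- The number of edges of a graph. -/
noncomputable def edgeCount [Fintype V] (G : SimpleGraph V) : ℕ := G.edgeSet.ncard

/-- The number of edges of `G` with both endpoints in `S`. -/
noncomputable def edgesIn [Fintype V] (G : SimpleGraph V) (S : Finset V) : ℕ :=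
  {e ∈ G.edgeSet | ∀ v ∈ e, v ∈ S}.ncard

/-- The number of edges of `G` with exactly one endpoint in `S`. -/
noncomputable def crossEdges [Fintype V] (G : SimpleGraph V) (S : Finset V) : ℕ :=
  {e ∈ G.edgeSet | (∃ v ∈ e, v ∈ S) ∧ ∃ v ∈ e, v ∉ S}.ncard

/-- The sum of the degrees (in `G`) of the vertices of `S`. -/
noncomputable def vol [Fintype V] (G : SimpleGraph V) (S : Finset V) : ℕ :=
  ∑ v ∈ S, G.degree v

/-- The modularity score of a partition of the vertex set. -/
noncomputable def modScore [Fintype V] [DecidableEq V] (G : SimpleGraph V)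
    (P : Finpartition (Finset.univ : Finset V)) : ℝ :=
  ∑ S ∈ P.parts,
    ((edgesIn G S : ℝ) / (edgeCount G : ℝ) -
      ((vol G S : ℝ) / (vol G Finset.univ : ℝ)) ^ 2)

/-- The modularity of a graph: the maximum of the modularity scores over all
partitions of the vertex set. -/
noncomputable def modularity [Fintype V] [DecidableEq V] (G : SimpleGraph V) : ℝ :=
  ⨆ P : Finpartition (Finset.univ : Finset V), modScore G P

/-- The Bernoulli measure on `Bool` with success probability `p`. -/
noncomputable def bernoulliB (p : ℝ) : Measure Bool :=
  ENNReal.ofReal p • Measure.dirac true + ENNReal.ofReal (1 - p) • Measure.dirac false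

/-- The law of the attribute assignment of the binomial random intersection graph
`G(n,m,p)`: each vertex chooses each attribute independently with probability `p`. -/
noncomputable def rigMeasure (n m : ℕ) (p : ℝ) : Measure (Fin n → Fin m → Bool) :=
  Measure.pi fun _ => Measure.pi fun _ => bernoulliB p

/-- The intersection graph determined by an attribute assignment: two distinct vertices
are adjacent iff they share an attribute. -/
def rigGraph {n m : ℕ} (ω : Fin n → Fin m → Bool) : SimpleGraph (Fin n) :=
  SimpleGraph.fromRel fun u v => ∃ i, ω u i = true ∧ ω v i = true


lemma two_edgesIn [Fintype V] (G : SimpleGraph V) (S : Finset V) :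
    2 * (edgesIn G S : ℝ) = ∑ u ∈ S, ∑ v ∈ S, (if G.Adj u v then (1:ℝ) else 0) := by
  let H : SimpleGraph V :=
    { Adj := fun u v => G.Adj u v ∧ u ∈ S ∧ v ∈ S
      symm := ⟨fun u v h => ⟨h.1.symm, h.2.2, h.2.1⟩⟩
      loopless := ⟨fun u h => G.loopless.irrefl u h.1⟩ }
  have hE : {e ∈ G.edgeSet | ∀ v ∈ e, v ∈ S} = H.edgeSet := by
    ext e
    induction e using Sym2.ind with
    | _ u v => simp [H]
  have h1 : edgesIn G S = H.edgeFinset.card := by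
    rw [edgesIn, hE, ← SimpleGraph.coe_edgeFinset, Set.ncard_coe_finset]
  rw [h1]
  have h2 := H.sum_degrees_eq_twice_card_edges
  have h3 : (2 * (H.edgeFinset.card : ℝ)) = ∑ u, (H.degree u : ℝ) := by
    exact_mod_cast h2.symm
  rw [h3]
  have h4 : ∀ u, (H.degree u : ℝ) = ∑ v, if H.Adj u v then (1:ℝ) else 0 := by
    intro u
    rw [← SimpleGraph.card_neighborFinset_eq_degree, SimpleGraph.neighborFinset_eq_filter,
      Finset.sum_boole]
  simp_rw [h4]
  rw [← Finset.sum_subset (Finset.subset_univ S)]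
  · refine Finset.sum_congr rfl fun u hu => ?_
    rw [← Finset.sum_subset (Finset.subset_univ S)]
    · refine Finset.sum_congr rfl fun v hv => ?_
      simp [H, hu, hv]
    · intro v _ hv
      simp [H, hv]
  · intro u _ hu
    simp [H, hu]

lemma edgeCount_eq [Fintype V] (G : SimpleGraph V) : edgeCount G = edgesIn G Finset.univ := by
  simp [edgeCount, edgesIn]

lemma vol_eq [Fintype V] (G : SimpleGraph V) (S : Finset V) :
    (vol G S : ℝ) = ∑ u ∈ S, ∑ v, (if G.Adj u v then (1:ℝ) else 0) := by
  rw [vol, Nat.cast_sum]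
  refine Finset.sum_congr rfl fun u _ => ?_
  rw [← SimpleGraph.card_neighborFinset_eq_degree, SimpleGraph.neighborFinset_eq_filter]
  simp

lemma modScore_eq [Fintype V] [DecidableEq V] (G : SimpleGraph V)
    (P : Finpartition (Finset.univ : Finset V)) (A : V → V → ℝ)
    (hA : ∀ u v, A u v = if G.Adj u v then (1:ℝ) else 0) :
    modScore G P = ∑ S ∈ P.parts, ((∑ u ∈ S, ∑ v ∈ S, A u v) / (∑ u, ∑ v, A u v)
      - ((∑ u ∈ S, ∑ v, A u v) / (∑ u, ∑ v, A u v)) ^ 2) := by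
  simp_rw [hA]
  rw [modScore]
  refine Finset.sum_congr rfl fun S _ => ?_
  rw [vol_eq, vol_eq, ← two_edgesIn, ← two_edgesIn, edgeCount_eq, mul_div_mul_left _ _ two_ne_zero]

lemma sum_parts [Fintype V] [DecidableEq V] (P : Finpartition (Finset.univ : Finset V))
    (f : V → ℝ) : ∑ S ∈ P.parts, ∑ u ∈ S, f u = ∑ u, f u := by
  have h := Finset.sum_biUnion (s := P.parts) (t := id) (f := f)
    (fun a ha b hb hab => P.disjoint ha hb hab)
  rw [P.biUnion_parts] at h
  exact h.symm

lemma exists_signs (Q : (V → ℝ) → ℝ)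
    (hQ : ∀ x y, Q (fun v => x v + y v) + Q (fun v => x v - y v) = 2 * Q x + 2 * Q y)
    {ι : Type*} (f : ι → V → ℝ) (s : Finset ι) :
    ∃ ε : ι → ℝ, (∀ S, ε S = 1 ∨ ε S = -1) ∧
      ∑ S ∈ s, Q (f S) ≤ Q (fun v => ∑ S ∈ s, ε S * f S v) := by
  induction s using Finset.induction_on with
  | empty =>
    refine ⟨fun _ => 1, fun _ => Or.inl rfl, ?_⟩
    have := hQ (fun _ => 0) (fun _ => 0)
    simp at this
    simp
    linarith
  | insert a s ha ih =>
    obtain ⟨ε, h1, h2⟩ := ih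
    have key := hQ (fun v => ∑ S ∈ s, ε S * f S v) (f a)
    have hs : ∀ c : ℝ, ∀ v, ∑ S ∈ insert a s, (Function.update ε a c) S * f S v
        = c * f a v + ∑ S ∈ s, ε S * f S v := by
      intro c v
      rw [Finset.sum_insert ha]
      congr 1
      · simp
      · refine Finset.sum_congr rfl fun S hS => ?_
        rw [Function.update_of_ne]
        rintro rfl
        exact ha hS
    rw [Finset.sum_insert ha]
    by_cases hc : Q (f a) + ∑ S ∈ s, Q (f S) ≤ Q (fun v => ∑ S ∈ s, ε S * f S v + f a v)
    · refine ⟨Function.update ε a 1, ?_, ?_⟩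
      · intro S
        by_cases h : S = a
        · subst h; simp
        · simp [Function.update_of_ne h, h1]
      · simp_rw [hs]
        simpa [add_comm] using hc
    · refine ⟨Function.update ε a (-1), ?_, ?_⟩
      · intro S
        by_cases h : S = a
        · subst h; simp
        · simp [Function.update_of_ne h, h1]
      · simp_rw [hs]
        have : (fun v => -1 * f a v + ∑ S ∈ s, ε S * f S v)
          = fun v => ∑ S ∈ s, ε S * f S v - f a v := by
          funext v; ring
        rw [this]
        push Not at hc
        linarith

lemma score_le [Fintype V] [DecidableEq V] (P : Finpartition (Finset.univ : Finset V))
    (A A' : V → V → ℝ) (h0 : ∀ u v, 0 ≤ A u v) (hle : ∀ u v, A u v ≤ A' u v)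
    (W T K D : ℝ) (hW : W = ∑ u, ∑ v, A u v) (hT : T = ∑ u, ∑ v, A' u v)
    (hTpos : 0 < T) (hTD : T - W ≤ D) (hD : D ≤ T / 2) (hK : 0 ≤ K)
    (hs : ∑ S ∈ P.parts, ((∑ u ∈ S, ∑ v ∈ S, A' u v) - (∑ u ∈ S, ∑ v, A' u v) ^ 2 / T) ≤ K) :
    ∑ S ∈ P.parts, ((∑ u ∈ S, ∑ v ∈ S, A u v) / W - ((∑ u ∈ S, ∑ v, A u v) / W) ^ 2)
      ≤ 2 * K / T + 8 * D / T := by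
  have hWpos : 0 < W := by linarith
  have h0' : ∀ u v, 0 ≤ A' u v := fun u v => (h0 u v).trans (hle u v)
  have hWT : W ≤ T := by
    rw [hW, hT]
    exact Finset.sum_le_sum fun u _ => Finset.sum_le_sum fun v _ => hle u v
  rw [Finset.sum_sub_distrib, ← Finset.sum_div] at hs ⊢
  simp_rw [div_pow]
  rw [← Finset.sum_div]
  set a := ∑ S ∈ P.parts, ∑ u ∈ S, ∑ v ∈ S, A u v
  set a' := ∑ S ∈ P.parts, ∑ u ∈ S, ∑ v ∈ S, A' u v
  set q := ∑ S ∈ P.parts, (∑ u ∈ S, ∑ v, A u v) ^ 2 with hq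
  set q' := ∑ S ∈ P.parts, (∑ u ∈ S, ∑ v, A' u v) ^ 2 with hq'
  have ha : a ≤ a' := Finset.sum_le_sum fun S _ => Finset.sum_le_sum fun u _ =>
    Finset.sum_le_sum fun v _ => hle u v
  have hq0 : 0 ≤ q' := Finset.sum_nonneg fun S _ => sq_nonneg _
  have hqq : q' - q ≤ 2 * T * (T - W) := by
    have e1 : T - W = ∑ S ∈ P.parts, ((∑ u ∈ S, ∑ v, A' u v) - ∑ u ∈ S, ∑ v, A u v) := by
      rw [Finset.sum_sub_distrib, sum_parts, sum_parts, hT, hW]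
    rw [hq, hq', ← Finset.sum_sub_distrib, e1, Finset.mul_sum]
    refine Finset.sum_le_sum fun S _ => ?_
    have b1 : ∑ u ∈ S, ∑ v, A' u v ≤ T := by
      rw [hT]
      exact Finset.sum_le_sum_of_subset_of_nonneg (Finset.subset_univ _)
        fun u _ _ => Finset.sum_nonneg fun v _ => h0' u v
    have b2 : ∑ u ∈ S, ∑ v, A u v ≤ ∑ u ∈ S, ∑ v, A' u v :=
      Finset.sum_le_sum fun u _ => Finset.sum_le_sum fun v _ => hle u v
    nlinarith
  have hD0 : 0 ≤ D := by linarith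
  have s1 : a / W ≤ (K + q' / T) / W := by gcongr; linarith
  have s2 : q' / T / W ≤ q' / W ^ 2 := by
    rw [div_div, pow_two]
    gcongr
  have s3 : (q' - 2 * T * D) / W ^ 2 ≤ q / W ^ 2 := by
    gcongr
    nlinarith
  have s4 : K / W ≤ 2 * K / T := by
    rw [div_le_div_iff₀ hWpos hTpos]
    nlinarith
  have s5 : 2 * T * D / W ^ 2 ≤ 8 * D / T := by
    rw [div_le_div_iff₀ (by positivity) hTpos]
    have : T ^ 2 ≤ 4 * W ^ 2 := by nlinarith
    nlinarith
  rw [add_div] at s1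
  rw [sub_div] at s3
  linarith

/-- numerical value of a Boolean -/
def bv (b : Bool) : ℝ := if b then 1 else 0
/-- sign of a Boolean -/
def sg (b : Bool) : ℝ := if b then 1 else -1
/-- size of a column -/
noncomputable def XX {n : ℕ} (c : Fin n → Bool) : ℝ := ∑ v, bv (c v)
/-- centred sign vector -/
noncomputable def tau {n : ℕ} (s : Fin n → Bool) (v : Fin n) : ℝ :=
  sg (s v) - (∑ u, sg (s u)) / n
/-- centred imbalance of a column -/
noncomputable def ZZ {n : ℕ} (s c : Fin n → Bool) : ℝ := ∑ v, bv (c v) * tau s v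
/-- truncated square -/
noncomputable def FF {n : ℕ} (μ : ℝ) (s c : Fin n → Bool) : ℝ :=
  if XX c ≤ 2 * μ then ZZ s c ^ 2 else 0
/-- column -/
def col {n m : ℕ} (ω : Fin n → Fin m → Bool) (i : Fin m) : Fin n → Bool := fun v => ω v i
/-- sum of squared deviations of column sizes -/
noncomputable def RR {n m : ℕ} (μ : ℝ) (ω : Fin n → Fin m → Bool) : ℝ :=
  ∑ i, (XX (col ω i) - μ) ^ 2
/-- diagonal count -/
noncomputable def D1 {n m : ℕ} (ω : Fin n → Fin m → Bool) : ℝ := ∑ v, ∑ i, bv (ω v i)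
/-- multiplicity count -/
noncomputable def D2 {n m : ℕ} (ω : Fin n → Fin m → Bool) : ℝ :=
  ∑ u, ∑ v, if u = v then 0 else ∑ i, ∑ j, if i = j then 0 else
    (bv (ω u i) * bv (ω v i)) * (bv (ω u j) * bv (ω v j))

lemma bv_nonneg (b : Bool) : 0 ≤ bv b := by cases b <;> simp [bv]
lemma bv_sq (b : Bool) : bv b * bv b = bv b := by cases b <;> simp [bv]
lemma sg_sq (b : Bool) : sg b ^ 2 = 1 := by cases b <;> simp [sg]
lemma abs_sg (b : Bool) : |sg b| = 1 := by cases b <;> simp [sg]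
lemma XX_nonneg {n : ℕ} (c : Fin n → Bool) : 0 ≤ XX c := Finset.sum_nonneg fun _ _ => bv_nonneg _

lemma abs_tau {n : ℕ} (s : Fin n → Bool) (v : Fin n) : |tau s v| ≤ 2 := by
  have hn : (0:ℝ) < n := by
    have := v.pos
    exact_mod_cast this
  have h1 : |∑ u, sg (s u)| ≤ n := by
    refine (Finset.abs_sum_le_sum_abs _ _).trans ?_
    simp [abs_sg]
  have h2 : |(∑ u, sg (s u)) / n| ≤ 1 := by
    rw [abs_div, abs_of_pos hn, div_le_one hn]
    exact h1
  calc |tau s v| ≤ |sg (s v)| + |(∑ u, sg (s u)) / n| := abs_sub _ _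
    _ ≤ 2 := by rw [abs_sg]; linarith

lemma ZZ_sq_le {n : ℕ} (s c : Fin n → Bool) : ZZ s c ^ 2 ≤ 4 * XX c ^ 2 := by
  have h : |ZZ s c| ≤ 2 * XX c := by
    unfold ZZ XX
    refine (Finset.abs_sum_le_sum_abs _ _).trans ?_
    rw [Finset.mul_sum]
    refine Finset.sum_le_sum fun v _ => ?_
    rw [abs_mul, abs_of_nonneg (bv_nonneg _), mul_comm]
    exact mul_le_mul_of_nonneg_right (abs_tau s v) (bv_nonneg _)
  have := sq_le_sq' (by linarith [neg_abs_le (ZZ s c)]) ((le_abs_self _).trans h)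
  linarith

lemma ZZ_le_FF {n : ℕ} (μ : ℝ) (hμ : 0 ≤ μ) (s c : Fin n → Bool) :
    ZZ s c ^ 2 ≤ FF μ s c + 16 * (XX c - μ) ^ 2 := by
  unfold FF
  split_ifs with h
  · nlinarith [sq_nonneg (XX c - μ)]
  · have := ZZ_sq_le s c
    push Not at h
    nlinarith

lemma D_entry {m : ℕ} (x : Fin m → ℝ) (hx : ∀ i, x i = 0 ∨ x i = 1) (a : ℝ)
    (ha : a = if ∃ i, x i = 1 then 1 else 0) :
    a ≤ ∑ i, x i ∧ ∑ i, x i - a ≤ ∑ i, ∑ j, if i = j then 0 else x i * x j := by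
  have hn : ∀ i, 0 ≤ x i := fun i => by rcases hx i with h | h <;> rw [h] <;> norm_num
  have e : ∑ i, ∑ j, (if i = j then 0 else x i * x j) = (∑ i, x i) ^ 2 - ∑ i, x i := by
    rw [pow_two, Finset.sum_mul_sum, ← Finset.sum_sub_distrib]
    refine Finset.sum_congr rfl fun i _ => ?_
    have : ∀ j, (if i = j then 0 else x i * x j) = x i * x j - if i = j then x i else 0 := by
      intro j
      split_ifs with h
      · subst h
        rcases hx i with h | h <;> rw [h] <;> norm_num
      · ring
    simp_rw [this]
    rw [Finset.sum_sub_distrib]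
    simp
  rw [e]
  by_cases h : ∃ i, x i = 1
  · rw [if_pos h] at ha
    obtain ⟨i, hi⟩ := h
    have : 1 ≤ ∑ i, x i := by
      rw [← hi]
      exact Finset.single_le_sum (fun j _ => hn j) (Finset.mem_univ i)
    subst ha
    exact ⟨this, by nlinarith⟩
  · rw [if_neg h] at ha
    have : ∑ i, x i = 0 := Finset.sum_eq_zero fun i _ => by
      rcases hx i with h' | h'
      · exact h'
      · exact absurd ⟨i, h'⟩ h
    rw [this, ha]; norm_num

lemma rig_adj {n m : ℕ} (ω : Fin n → Fin m → Bool) (u v : Fin n) :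
    (rigGraph ω).Adj u v ↔ u ≠ v ∧ ∃ i, bv (ω u i) * bv (ω v i) = 1 := by
  have : ∀ a b : Bool, bv a * bv b = 1 ↔ a = true ∧ b = true := by
    intro a b; cases a <;> cases b <;> simp [bv]
  simp only [rigGraph, SimpleGraph.fromRel_adj, this]
  constructor
  · rintro ⟨h, ⟨i, h1, h2⟩ | ⟨i, h1, h2⟩⟩
    · exact ⟨h, i, h1, h2⟩
    · exact ⟨h, i, h2, h1⟩
  · rintro ⟨h, i, h1, h2⟩
    exact ⟨h, Or.inl ⟨i, h1, h2⟩⟩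

lemma entry {n m : ℕ} (ω : Fin n → Fin m → Bool) (u v : Fin n) :
    (if (rigGraph ω).Adj u v then (1:ℝ) else 0) ≤ ∑ i, bv (ω u i) * bv (ω v i) ∧
    ∑ i, bv (ω u i) * bv (ω v i) - (if (rigGraph ω).Adj u v then (1:ℝ) else 0)
      ≤ (if u = v then ∑ i, bv (ω u i) else 0) + (if u = v then 0 else ∑ i, ∑ j,
        if i = j then 0 else (bv (ω u i) * bv (ω v i)) * (bv (ω u j) * bv (ω v j))) := by
  simp only [rig_adj]
  by_cases h : u = v
  · subst h
    simp only [ne_eq, not_true_eq_false, false_and, if_false, if_true, bv_sq]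
    exact ⟨Finset.sum_nonneg fun _ _ => bv_nonneg _, by simp⟩
  · have hx : ∀ i, bv (ω u i) * bv (ω v i) = 0 ∨ bv (ω u i) * bv (ω v i) = 1 := by
      intro i
      cases ω u i <;> cases ω v i <;> simp [bv]
    have := D_entry (fun i => bv (ω u i) * bv (ω v i)) hx _ rfl
    simpa [h] using this

lemma D_le {n m : ℕ} (ω : Fin n → Fin m → Bool) :
    ∑ u, ∑ v, ∑ i, bv (ω u i) * bv (ω v i) -
      ∑ u, ∑ v, (if (rigGraph ω).Adj u v then (1:ℝ) else 0) ≤ D1 ω + D2 ω := by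
  have e1 : D1 ω = ∑ u : Fin n, ∑ v : Fin n, if u = v then ∑ i, bv (ω u i) else 0 := by
    simp [D1]
  rw [e1, D2, ← Finset.sum_sub_distrib, ← Finset.sum_add_distrib]
  refine Finset.sum_le_sum fun u _ => ?_
  rw [← Finset.sum_sub_distrib, ← Finset.sum_add_distrib]
  exact Finset.sum_le_sum fun v _ => (entry ω u v).2

lemma sum_eq_X {n m : ℕ} (ω : Fin n → Fin m → Bool) (S S' : Finset (Fin n)) :
    ∑ u ∈ S, ∑ v ∈ S', ∑ i, bv (ω u i) * bv (ω v i) =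
      ∑ i, (∑ u ∈ S, bv (ω u i)) * (∑ v ∈ S', bv (ω v i)) := by
  have : ∀ u ∈ S, ∑ v ∈ S', ∑ i, bv (ω u i) * bv (ω v i) =
      ∑ i, ∑ v ∈ S', bv (ω u i) * bv (ω v i) := fun u _ => Finset.sum_comm
  rw [Finset.sum_congr rfl this, Finset.sum_comm]
  refine Finset.sum_congr rfl fun i _ => ?_
  rw [Finset.sum_mul_sum]

/-- the quadratic form -/
noncomputable def QQ {n m : ℕ} (ω : Fin n → Fin m → Bool) (x : Fin n → ℝ) : ℝ :=
  ∑ i, (∑ v, bv (ω v i) * x v) ^ 2 -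
    (∑ i, (∑ v, bv (ω v i) * x v) * XX (col ω i)) ^ 2 / ∑ i, XX (col ω i) ^ 2

lemma QQ_par {n m : ℕ} (ω : Fin n → Fin m → Bool) (x y : Fin n → ℝ) :
    QQ ω (fun v => x v + y v) + QQ ω (fun v => x v - y v) = 2 * QQ ω x + 2 * QQ ω y := by
  simp only [QQ, mul_add, mul_sub, Finset.sum_add_distrib, Finset.sum_sub_distrib, add_mul, sub_mul,
    add_sq, sub_sq, add_div, sub_div]
  ring

lemma QQ_le {n m : ℕ} (ω : Fin n → Fin m → Bool) (s : Fin n → Bool)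
    (hT : 0 < ∑ i, XX (col ω i) ^ 2) :
    QQ ω (fun v => sg (s v)) ≤ ∑ i, ZZ s (col ω i) ^ 2 := by
  set t : ℝ := (∑ u, sg (s u)) / n with ht
  have hZ : ∀ i, ZZ s (col ω i) = (∑ v, bv (ω v i) * sg (s v)) - t * XX (col ω i) := by
    intro i
    simp only [ZZ, tau, XX, col, mul_sub, Finset.sum_sub_distrib, Finset.mul_sum, ← ht]
    congr 1
    exact Finset.sum_congr rfl fun _ _ => mul_comm _ _
  simp_rw [hZ]
  unfold QQ
  set y := fun i => ∑ v, bv (ω v i) * sg (s v)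
  set T := ∑ i, XX (col ω i) ^ 2 with hTd
  have e : ∑ i, (y i - t * XX (col ω i)) ^ 2 =
      ∑ i, y i ^ 2 - 2 * t * (∑ i, y i * XX (col ω i)) + t ^ 2 * T := by
    rw [hTd, Finset.mul_sum, Finset.mul_sum, ← Finset.sum_sub_distrib, ← Finset.sum_add_distrib]
    exact Finset.sum_congr rfl fun i _ => by ring
  change ∑ i, y i ^ 2 - (∑ i, y i * XX (col ω i)) ^ 2 / T ≤ ∑ i, (y i - t * XX (col ω i)) ^ 2
  rw [e]
  set c := ∑ i, y i * XX (col ω i)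
  have : 0 ≤ (c - t * T) ^ 2 / T := by positivity
  have e2 : (c - t * T) ^ 2 / T = c ^ 2 / T - 2 * t * c + t ^ 2 * T := by
    field_simp
    ring
  linarith

lemma sum_QQ_le {n m : ℕ} (ω : Fin n → Fin m → Bool)
    (P : Finpartition (Finset.univ : Finset (Fin n))) (K : ℝ)
    (hT : 0 < ∑ i, XX (col ω i) ^ 2)
    (hK : ∀ s : Fin n → Bool, ∑ i, ZZ s (col ω i) ^ 2 ≤ K) :
    ∑ S ∈ P.parts, QQ ω (fun v => if v ∈ S then 1 else 0) ≤ K := by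
  obtain ⟨ε, h1, h2⟩ := exists_signs (QQ ω) (QQ_par ω)
    (fun (S : Finset (Fin n)) v => if v ∈ S then (1:ℝ) else 0) P.parts
  refine h2.trans ?_
  have hs : (fun v => ∑ S ∈ P.parts, ε S * if v ∈ S then (1:ℝ) else 0)
      = fun v => sg (decide (ε (P.part v) = 1)) := by
    funext v
    rw [Finset.sum_eq_single (P.part v)]
    · rw [if_pos (P.mem_part (Finset.mem_univ v))]
      rcases h1 (P.part v) with h | h <;> rw [h] <;> norm_num [sg]
    · intro S hS hne
      rw [if_neg, mul_zero]
      intro hv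
      exact hne (P.part_eq_of_mem hS hv).symm
    · intro h
      exact absurd (P.part_mem.2 (Finset.mem_univ v)) h
  rw [hs]
  exact (QQ_le ω _ hT).trans (hK _)

lemma QQ_ind {n m : ℕ} (ω : Fin n → Fin m → Bool) (S : Finset (Fin n)) :
    QQ ω (fun v => if v ∈ S then 1 else 0) =
     (∑ u ∈ S, ∑ v ∈ S, ∑ i, bv (ω u i) * bv (ω v i)) -
      (∑ u ∈ S, ∑ v, ∑ i, bv (ω u i) * bv (ω v i)) ^ 2 / ∑ i, XX (col ω i) ^ 2 := by
  rw [sum_eq_X, sum_eq_X, QQ]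
  have : ∀ i, ∑ v, bv (ω v i) * (if v ∈ S then (1:ℝ) else 0) = ∑ v ∈ S, bv (ω v i) := by
    intro i
    simp
  simp_rw [this]
  simp only [XX, col, pow_two]

lemma modularity_le {n m : ℕ} (ω : Fin n → Fin m → Bool) (K D : ℝ) (hK0 : 0 ≤ K)
    (hT : 0 < ∑ i, XX (col ω i) ^ 2)
    (hK : ∀ s : Fin n → Bool, ∑ i, ZZ s (col ω i) ^ 2 ≤ K)
    (hD : D1 ω + D2 ω ≤ D) (hDT : D ≤ (∑ i, XX (col ω i) ^ 2) / 2) :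
    modularity (rigGraph ω) ≤ 2 * K / (∑ i, XX (col ω i) ^ 2) +
      8 * D / (∑ i, XX (col ω i) ^ 2) := by
  have hTe : ∑ i, XX (col ω i) ^ 2 = ∑ u, ∑ v, ∑ i, bv (ω u i) * bv (ω v i) := by
    rw [sum_eq_X]
    simp only [XX, col, pow_two]
  haveI : Nonempty (Finpartition (Finset.univ : Finset (Fin n))) := ⟨⊥⟩
  refine ciSup_le fun P => ?_
  rw [modScore_eq (rigGraph ω) P _ (fun u v => rfl)]
  refine score_le P _ (fun u v => ∑ i, bv (ω u i) * bv (ω v i)) ?_ ?_ _ _ K D rfl hTe hT ?_ hDT hK0 ?_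
  · intro u v
    split_ifs <;> norm_num
  · exact fun u v => (entry ω u v).1
  · rw [hTe]
    exact (D_le ω).trans hD
  · have := sum_QQ_le ω P K hT hK
    simp_rw [QQ_ind] at this
    exact this

lemma good_det {n m : ℕ} (ω : Fin n → Fin m → Bool) (hm : 0 < m) (μ s y : ℝ) (hμ : 0 < μ)
    (hs0 : 0 ≤ s) (hy0 : 0 ≤ y) (hs : s ≤ 1 / 16) (hy : y ≤ 1 / 16)
    (hR : RR μ ω ≤ m * μ ^ 2 * s) (h1 : D1 ω ≤ m * μ ^ 2 * s) (h2 : D2 ω ≤ m * μ ^ 2 * y)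
    (hF : ∀ σ : Fin n → Bool, ∑ i, FF μ σ (col ω i) ≤ 32 * n * μ ^ 2 + 2 * m * μ) :
    modularity (rigGraph ω) ≤ 256 * (n / m) + 16 / μ + 160 * s + 32 * y := by
  have hm' : (0:ℝ) < m := by exact_mod_cast hm
  set M : ℝ := m * μ ^ 2 with hM
  have hMpos : 0 < M := by positivity
  set T := ∑ i, XX (col ω i) ^ 2 with hT
  have hTM : M ≤ 2 * T + 2 * RR μ ω := by
    have : M = ∑ i : Fin m, μ ^ 2 := by simp [hM]
    rw [this, hT, RR, Finset.mul_sum, Finset.mul_sum, ← Finset.sum_add_distrib]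
    refine Finset.sum_le_sum fun i _ => ?_
    nlinarith [sq_nonneg (2 * XX (col ω i) - μ)]
  have hT4 : M / 4 ≤ T := by nlinarith
  have hTpos : 0 < T := by linarith
  set K : ℝ := 32 * n * μ ^ 2 + 2 * m * μ + 16 * (M * s) with hK
  have hK0 : 0 ≤ K := by positivity
  have key := modularity_le ω K (M * s + M * y) hK0 hTpos ?_ (by linarith) (by rw [← hT]; nlinarith)
  · refine key.trans ?_
    rw [← hT]
    have a1 : 2 * K / T ≤ 2 * K / (M / 4) := by gcongr
    have a2 : 8 * (M * s + M * y) / T ≤ 8 * (M * s + M * y) / (M / 4) := by gcongr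
    have e1 : 2 * K / (M / 4) = 256 * (n / m) + 16 / μ + 128 * s := by
      rw [hK, hM]; field_simp; ring
    have e2 : 8 * (M * s + M * y) / (M / 4) = 32 * s + 32 * y := by
      field_simp; ring
    linarith
  · intro σ
    calc ∑ i, ZZ σ (col ω i) ^ 2 ≤ ∑ i, (FF μ σ (col ω i) + 16 * (XX (col ω i) - μ) ^ 2) :=
          Finset.sum_le_sum fun i _ => ZZ_le_FF μ hμ.le σ _
      _ = ∑ i, FF μ σ (col ω i) + 16 * RR μ ω := by
          rw [Finset.sum_add_distrib, RR, Finset.mul_sum]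
      _ ≤ K := by linarith [hF σ]

/-- Bernoulli weights -/
noncomputable def wt (p : ℝ) (b : Bool) : ℝ := if b then p else 1 - p
/-- expectation over a single column -/
noncomputable def E1 {n : ℕ} (p : ℝ) (f : (Fin n → Bool) → ℝ) : ℝ :=
  ∑ c : Fin n → Bool, (∏ v, wt p (c v)) * f c
/-- expectation over everything -/
noncomputable def EE {n m : ℕ} (p : ℝ) (f : (Fin n → Fin m → Bool) → ℝ) : ℝ :=
  ∑ ω : Fin n → Fin m → Bool, (∏ v, ∏ i, wt p (ω v i)) * f ω

section
variable {n m : ℕ} {p : ℝ}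

lemma wt_nonneg (h0 : 0 ≤ p) (h1 : p ≤ 1) (b : Bool) : 0 ≤ wt p b := by
  cases b <;> simp [wt] <;> linarith

lemma E1_prod (h : Fin n → Bool → ℝ) :
    E1 p (fun c => ∏ v, h v (c v)) = ∏ v, (p * h v true + (1 - p) * h v false) := by
  have := Finset.sum_prod_piFinset (Finset.univ : Finset Bool) (fun v b => wt p b * h v b)
  rw [Fintype.piFinset_univ] at this
  simp only [E1, ← Finset.prod_mul_distrib]
  rw [this]
  simp [wt]

lemma EE_prod (g : Fin m → (Fin n → Bool) → ℝ) :
    EE p (fun ω : Fin n → Fin m → Bool => ∏ i, g i (col ω i)) = ∏ i, E1 p (g i) := by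
  have := Finset.sum_prod_piFinset (Finset.univ : Finset (Fin n → Bool))
    (fun (i : Fin m) c => (∏ v, wt p (c v)) * g i c)
  rw [Fintype.piFinset_univ] at this
  simp only [E1]
  rw [← this, EE]
  refine Fintype.sum_equiv (Equiv.piComm _) _ _ fun ω => ?_
  rw [Finset.prod_comm, ← Finset.prod_mul_distrib]
  rfl

lemma E1_add (f g : (Fin n → Bool) → ℝ) : E1 p (fun c => f c + g c) = E1 p f + E1 p g := by
  simp [E1, mul_add, Finset.sum_add_distrib]
lemma E1_mul (a : ℝ) (f : (Fin n → Bool) → ℝ) : E1 p (fun c => a * f c) = a * E1 p f := by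
  simp only [E1, Finset.mul_sum]
  exact Finset.sum_congr rfl fun _ _ => by ring
lemma E1_sum {ι : Type*} (s : Finset ι) (f : ι → (Fin n → Bool) → ℝ) :
    E1 p (fun c => ∑ i ∈ s, f i c) = ∑ i ∈ s, E1 p (f i) := by
  simp only [E1, Finset.mul_sum]
  exact Finset.sum_comm
lemma E1_mono (h0 : 0 ≤ p) (h1 : p ≤ 1) {f g : (Fin n → Bool) → ℝ} (h : ∀ c, f c ≤ g c) :
    E1 p f ≤ E1 p g :=
  Finset.sum_le_sum fun c _ => mul_le_mul_of_nonneg_left (h c)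
    (Finset.prod_nonneg fun _ _ => wt_nonneg h0 h1 _)
lemma E1_one : E1 p (fun _ : Fin n → Bool => 1) = 1 := by
  have := E1_prod (p := p) (fun (_ : Fin n) _ => 1)
  simpa using this

lemma EE_add (f g : (Fin n → Fin m → Bool) → ℝ) :
    EE p (fun c => f c + g c) = EE p f + EE p g := by
  simp [EE, mul_add, Finset.sum_add_distrib]
lemma EE_mul (a : ℝ) (f : (Fin n → Fin m → Bool) → ℝ) : EE p (fun c => a * f c) = a * EE p f := by
  simp only [EE, Finset.mul_sum]
  exact Finset.sum_congr rfl fun _ _ => by ring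
lemma EE_sum {ι : Type*} (s : Finset ι) (f : ι → (Fin n → Fin m → Bool) → ℝ) :
    EE p (fun c => ∑ i ∈ s, f i c) = ∑ i ∈ s, EE p (f i) := by
  simp only [EE, Finset.mul_sum]
  exact Finset.sum_comm
lemma EE_mono (h0 : 0 ≤ p) (h1 : p ≤ 1) {f g : (Fin n → Fin m → Bool) → ℝ}
    (h : ∀ c, f c ≤ g c) : EE p f ≤ EE p g :=
  Finset.sum_le_sum fun c _ => mul_le_mul_of_nonneg_left (h c)
    (Finset.prod_nonneg fun _ _ => Finset.prod_nonneg fun _ _ => wt_nonneg h0 h1 _)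
lemma EE_one : EE p (fun _ : Fin n → Fin m → Bool => 1) = 1 := by
  have := EE_prod (p := p) (fun (_ : Fin m) (_ : Fin n → Bool) => 1)
  simpa [E1_one] using this

lemma EE_col (i : Fin m) (g : (Fin n → Bool) → ℝ) :
    EE p (fun ω : Fin n → Fin m → Bool => g (col ω i)) = E1 p g := by
  have := EE_prod (p := p) (fun (k : Fin m) (c : Fin n → Bool) => if k = i then g c else 1)
  simp only [Finset.prod_ite_eq', Finset.mem_univ, if_true] at this
  rw [this, Finset.prod_eq_single i]
  · simp
  · intro b _ hb
    simp [hb, E1_one]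
  · simp

lemma EE_col2 (i j : Fin m) (hij : i ≠ j) (g h : (Fin n → Bool) → ℝ) :
    EE p (fun ω : Fin n → Fin m → Bool => g (col ω i) * h (col ω j)) = E1 p g * E1 p h := by
  have := EE_prod (p := p) (fun (k : Fin m) (c : Fin n → Bool) =>
    (if k = i then g c else 1) * (if k = j then h c else 1))
  simp only [Finset.prod_mul_distrib, Finset.prod_ite_eq', Finset.mem_univ, if_true] at this
  rw [this]
  have : ∀ k, E1 p (fun c : Fin n → Bool => (if k = i then g c else 1) * (if k = j then h c else 1))
      = (if k = i then E1 p g else 1) * (if k = j then E1 p h else 1) := by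
    intro k
    by_cases hi : k = i
    · have hj : k ≠ j := fun h => hij (hi.symm.trans h)
      simp [hi, hij]
    · by_cases hj : k = j
      · simp [hi, hj, Ne.symm hij]
      · simp [hi, hj, E1_one]
  simp only [this, Finset.prod_mul_distrib, Finset.prod_ite_eq', Finset.mem_univ, if_true]

lemma E1_vert (u : Fin n) (g : Bool → ℝ) :
    E1 p (fun c : Fin n → Bool => g (c u)) = p * g true + (1 - p) * g false := by
  have := E1_prod (p := p) (fun (k : Fin n) (b : Bool) => if k = u then g b else 1)
  simp only [Finset.prod_ite_eq', Finset.mem_univ, if_true] at this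
  rw [this, Finset.prod_eq_single u]
  · simp
  · intro b _ hb
    simp [hb]
  · simp

lemma E1_vert2 (u v : Fin n) (huv : u ≠ v) (g h : Bool → ℝ) :
    E1 p (fun c : Fin n → Bool => g (c u) * h (c v)) =
      (p * g true + (1 - p) * g false) * (p * h true + (1 - p) * h false) := by
  have := E1_prod (p := p) (fun (k : Fin n) (b : Bool) =>
    (if k = u then g b else 1) * (if k = v then h b else 1))
  simp only [Finset.prod_mul_distrib, Finset.prod_ite_eq', Finset.mem_univ, if_true] at this
  rw [this]
  have : ∀ k, (p * ((if k = u then g true else 1) * (if k = v then h true else 1)) + (1 - p) *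
      ((if k = u then g false else 1) * (if k = v then h false else 1)))
      = (if k = u then (p * g true + (1 - p) * g false) else 1) *
        (if k = v then (p * h true + (1 - p) * h false) else 1) := by
    intro k
    by_cases hi : k = u
    · simp [hi, huv]
    · by_cases hj : k = v
      · simp [hj, Ne.symm huv]
      · simp [hi, hj]
  simp only [this, Finset.prod_mul_distrib, Finset.prod_ite_eq', Finset.mem_univ, if_true]

/-- second moment of a centred linear form -/
lemma E1_lin_sq (h0 : 0 ≤ p) (t : Fin n → ℝ) :
    E1 p (fun c : Fin n → Bool => (∑ v, (bv (c v) - p) * t v) ^ 2) ≤ p * ∑ v, t v ^ 2 := by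
  simp only [pow_two, Finset.sum_mul_sum]
  rw [E1_sum]
  simp only [E1_sum]
  rw [Finset.mul_sum]
  refine Finset.sum_le_sum fun u _ => ?_
  rw [Finset.sum_eq_single u]
  · rw [E1_vert u (fun b => (bv b - p) * t u * ((bv b - p) * t u))]
    simp only [bv, if_true]
    have e : p * ((1 - p) * t u * ((1 - p) * t u)) + (1 - p) * ((0 - p) * t u * ((0 - p) * t u))
      = p * (t u * t u) - p ^ 2 * (t u * t u) := by ring
    simp only [Bool.false_eq_true, if_false]
    rw [e]
    have : 0 ≤ p ^ 2 * (t u * t u) := mul_nonneg (sq_nonneg _) (mul_self_nonneg _)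
    linarith
  · intro v _ hv
    rw [E1_vert2 u v hv.symm (fun b => (bv b - p) * t u) (fun b => (bv b - p) * t v)]
    simp only [bv, if_true, Bool.false_eq_true, if_false]
    ring
  · simp

lemma EE_RR (h0 : 0 ≤ p) : EE p (fun ω : Fin n → Fin m → Bool => RR (n * p) ω) ≤ m * (n * p) := by
  simp only [RR]
  rw [EE_sum]
  have : ∀ i : Fin m, EE p (fun ω : Fin n → Fin m → Bool => (XX (col ω i) - n * p) ^ 2) ≤ n * p := by
    intro i
    rw [EE_col i (fun c : Fin n → Bool => (XX c - n * p) ^ 2)]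
    have h := E1_lin_sq h0 (fun _ : Fin n => (1:ℝ))
    simp only [mul_one, Finset.sum_sub_distrib] at h
    simpa [XX, mul_comm p] using h
  calc _ ≤ ∑ i : Fin m, (n * p : ℝ) := Finset.sum_le_sum fun i _ => this i
    _ = _ := by simp

lemma EE_D1 : EE p (fun ω : Fin n → Fin m → Bool => D1 ω) = m * (n * p) := by
  simp only [D1]
  rw [EE_sum]
  simp only [EE_sum]
  have : ∀ v i, EE p (fun ω : Fin n → Fin m → Bool => bv (ω v i)) = p := by
    intro v i
    have := EE_col (p := p) i (fun c : Fin n → Bool => bv (c v))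
    rw [E1_vert v bv] at this
    simp only [col] at this
    rw [this]
    simp [bv]
  simp only [this]
  simp
  ring

lemma EE_zero : EE p (fun _ : Fin n → Fin m → Bool => 0) = 0 := by simp [EE]

lemma EE_D2 : EE p (fun ω : Fin n → Fin m → Bool => D2 ω) ≤ n ^ 2 * m ^ 2 * p ^ 4 := by
  simp only [D2]
  rw [EE_sum]
  simp only [EE_sum]
  have hp4 : 0 ≤ p ^ 4 := by positivity
  have : ∀ u v, EE p (fun ω : Fin n → Fin m → Bool => if u = v then 0 else ∑ i, ∑ j,
      if i = j then 0 else (bv (ω u i) * bv (ω v i)) * (bv (ω u j) * bv (ω v j)))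
      ≤ m ^ 2 * p ^ 4 := by
    intro u v
    by_cases huv : u = v
    · simp only [huv, if_true, EE_zero]
      positivity
    · simp only [huv, if_false]
      rw [EE_sum]
      simp only [EE_sum]
      calc _ ≤ ∑ i : Fin m, ∑ j : Fin m, p ^ 4 := by
            refine Finset.sum_le_sum fun i _ => Finset.sum_le_sum fun j _ => ?_
            by_cases hij : i = j
            · simp only [hij, if_true, EE_zero]
              exact hp4
            · simp only [hij, if_false]
              have h := EE_col2 (p := p) i j hij (fun c : Fin n → Bool => bv (c u) * bv (c v))
                (fun c : Fin n → Bool => bv (c u) * bv (c v))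
              rw [E1_vert2 u v huv bv bv] at h
              simp only [col] at h
              rw [h]
              simp only [bv, if_true, Bool.false_eq_true, if_false]
              apply le_of_eq; ring
        _ = _ := by simp; ring
  calc _ ≤ ∑ u : Fin n, ∑ v : Fin n, (m ^ 2 * p ^ 4 : ℝ) :=
        Finset.sum_le_sum fun u _ => Finset.sum_le_sum fun v _ => this u v
    _ = _ := by simp; ring

lemma sum_tau (s : Fin n → Bool) : ∑ v, tau s v = 0 := by
  rcases Nat.eq_zero_or_pos n with h | h
  · subst h; simp
  · have : (n:ℝ) ≠ 0 := by positivity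
    simp only [tau, Finset.sum_sub_distrib]
    simp
    field_simp
    ring

lemma sum_tau_sq (s : Fin n → Bool) : ∑ v, tau s v ^ 2 ≤ n := by
  have h : ∀ v, tau s v ^ 2 = 1 - ((∑ u, sg (s u)) / n) ^ 2 - 2 * ((∑ u, sg (s u)) / n) * tau s v := by
    intro v
    have := sg_sq (s v)
    unfold tau
    linear_combination this
  simp only [h, Finset.sum_sub_distrib]
  rw [← Finset.mul_sum, sum_tau]
  simp
  positivity

lemma ZZ_eq (s c : Fin n → Bool) : ZZ s c = ∑ v, (bv (c v) - p) * tau s v := by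
  simp only [ZZ, sub_mul, Finset.sum_sub_distrib]
  rw [← Finset.mul_sum, sum_tau]
  ring

lemma FF_nonneg (μ : ℝ) (s c : Fin n → Bool) : 0 ≤ FF μ s c := by
  unfold FF; split_ifs <;> positivity

lemma FF_le (μ : ℝ) (s c : Fin n → Bool) : FF μ s c ≤ 16 * μ ^ 2 := by
  unfold FF
  split_ifs with h
  · have := ZZ_sq_le s c
    have := XX_nonneg c
    nlinarith
  · positivity

lemma E1_FF (h0 : 0 ≤ p) (h1 : p ≤ 1) (μ : ℝ) (s : Fin n → Bool) :
    E1 p (FF μ s) ≤ n * p := by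
  calc E1 p (FF μ s) ≤ E1 p (fun c => (∑ v, (bv (c v) - p) * tau s v) ^ 2) := by
        refine E1_mono h0 h1 fun c => ?_
        rw [← ZZ_eq]
        unfold FF; split_ifs
        · exact le_rfl
        · positivity
    _ ≤ p * ∑ v, tau s v ^ 2 := E1_lin_sq h0 _
    _ ≤ n * p := by nlinarith [sum_tau_sq s]

lemma exp_le_lin {x : ℝ} (h0 : 0 ≤ x) (h1 : x ≤ 1) : Real.exp x ≤ 1 + 2 * x := by
  have := Real.abs_exp_sub_one_le (x := x) (by rwa [abs_of_nonneg h0])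
  rw [abs_of_nonneg h0] at this
  linarith [le_abs_self (Real.exp x - 1)]

lemma EE_exp (h0 : 0 ≤ p) (h1 : p ≤ 1) (hn : 0 < (n * p : ℝ)) (s : Fin n → Bool) :
    EE p (fun ω : Fin n → Fin m → Bool => Real.exp ((∑ i, FF (n * p) s (col ω i)
      - (32 * n * (n * p) ^ 2 + 2 * m * (n * p))) / (16 * (n * p) ^ 2))) ≤ Real.exp (-(2 * n)) := by
  set μ : ℝ := n * p with hμ
  have e : ∀ ω : Fin n → Fin m → Bool, Real.exp ((∑ i, FF μ s (col ω i)
      - (32 * n * μ ^ 2 + 2 * m * μ)) / (16 * μ ^ 2)) =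
      Real.exp (-(2 * n) - 2 * m * μ / (16 * μ ^ 2)) *
        ∏ i, Real.exp (FF μ s (col ω i) / (16 * μ ^ 2)) := by
    intro ω
    rw [← Real.exp_sum, ← Real.exp_add, ← Finset.sum_div]
    congr 1
    field_simp
    ring
  simp only [e]
  rw [EE_mul, EE_prod (fun _ c => Real.exp (FF μ s c / (16 * μ ^ 2)))]
  have hE : E1 p (fun c : Fin n → Bool => Real.exp (FF μ s c / (16 * μ ^ 2))) ≤
      Real.exp (2 * μ / (16 * μ ^ 2)) := by
    calc _ ≤ E1 p (fun c : Fin n → Bool => 1 + (2 / (16 * μ ^ 2)) * FF μ s c) := by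
          refine E1_mono h0 h1 fun c => ?_
          have := exp_le_lin (x := FF μ s c / (16 * μ ^ 2))
            (div_nonneg (FF_nonneg _ _ _) (by positivity))
            ((div_le_one (by positivity)).2 (FF_le _ _ _))
          refine this.trans (le_of_eq ?_)
          ring
      _ = 1 + (2 / (16 * μ ^ 2)) * E1 p (FF μ s) := by
          rw [E1_add, E1_one, E1_mul]
      _ ≤ 1 + (2 / (16 * μ ^ 2)) * μ := by
          have := E1_FF h0 h1 μ s
          gcongr
      _ ≤ Real.exp (2 * μ / (16 * μ ^ 2)) := by
          have := Real.add_one_le_exp (2 * μ / (16 * μ ^ 2))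
          refine le_trans (le_of_eq ?_) this
          ring
  have hE0 : 0 ≤ E1 p (fun c : Fin n → Bool => Real.exp (FF μ s c / (16 * μ ^ 2))) :=
    Finset.sum_nonneg fun c _ => mul_nonneg (Finset.prod_nonneg fun _ _ => wt_nonneg h0 h1 _)
      (Real.exp_pos _).le
  calc _ ≤ Real.exp (-(2 * n) - 2 * m * μ / (16 * μ ^ 2)) *
        ∏ i : Fin m, Real.exp (2 * μ / (16 * μ ^ 2)) := by
        gcongr
    _ = Real.exp (-(2 * n)) := by
        rw [← Real.exp_sum, ← Real.exp_add]
        congr 1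
        simp
        ring

lemma rig_real (h0 : 0 ≤ p) (h1 : p ≤ 1) (S : Set (Fin n → Fin m → Bool)) :
    rigMeasure n m p S = ENNReal.ofReal (EE p (fun ω => if ω ∈ S then 1 else 0)) := by
  have hb : ∀ b : Bool, bernoulliB p {b} = ENNReal.ofReal (wt p b) := by
    intro b
    cases b <;> simp [bernoulliB, wt]
  have : IsProbabilityMeasure (bernoulliB p) := ⟨by
    simp only [bernoulliB, Measure.coe_add, Measure.coe_smul, Pi.add_apply, Pi.smul_apply,
      measure_univ, smul_eq_mul, mul_one]
    rw [← ENNReal.ofReal_add h0 (by linarith)]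
    simp⟩
  have hs : ∀ ω : Fin n → Fin m → Bool, rigMeasure n m p {ω} =
      ENNReal.ofReal (∏ v, ∏ i, wt p (ω v i)) := by
    intro ω
    rw [rigMeasure, Measure.pi_singleton, ENNReal.ofReal_prod_of_nonneg]
    · refine Finset.prod_congr rfl fun v _ => ?_
      rw [Measure.pi_singleton, ENNReal.ofReal_prod_of_nonneg]
      · exact Finset.prod_congr rfl fun i _ => hb _
      · exact fun _ _ => wt_nonneg h0 h1 _
    · exact fun _ _ => Finset.prod_nonneg fun _ _ => wt_nonneg h0 h1 _
  have hS : S = ((Finset.univ.filter (· ∈ S) : Finset (Fin n → Fin m → Bool)) : Set _) := by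
    ext; simp
  conv_lhs => rw [hS]
  rw [← sum_measure_singleton, EE]
  simp only [hs, mul_ite, mul_one, mul_zero]
  rw [← Finset.sum_filter, ENNReal.ofReal_sum_of_nonneg]
  exact fun _ _ => Finset.prod_nonneg fun _ _ => Finset.prod_nonneg fun _ _ => wt_nonneg h0 h1 _

end

lemma prob_bound {n m : ℕ} {p : ℝ} (hn : 0 < n) (hm : 0 < m) (h0 : 0 < p) (h1 : p ≤ 1)
    (s y B : ℝ) (hs0 : 0 < s) (hy0 : 0 < y) (hs : s ≤ 1 / 16) (hy : y ≤ 1 / 16)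
    (hB : 256 * ((n : ℝ) / m) + 16 / (n * p) + 160 * s + 32 * y ≤ B) :
    ENNReal.ofReal (1 - (2 / (n * p * s) + m * p ^ 2 / y + Real.exp (-n))) ≤
      rigMeasure n m p {ω | modularity (rigGraph ω) ≤ B} := by
  have hn' : (0:ℝ) < n := by exact_mod_cast hn
  have hm' : (0:ℝ) < m := by exact_mod_cast hm
  have hμ : (0:ℝ) < n * p := by positivity
  rw [rig_real h0.le h1]
  apply ENNReal.ofReal_le_ofReal
  set S : Set (Fin n → Fin m → Bool) := {ω | modularity (rigGraph ω) ≤ B} with hS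
  set M : ℝ := m * (n * p) ^ 2 with hM
  have hMpos : 0 < M := by positivity
  set ex : (Fin n → Bool) → (Fin n → Fin m → Bool) → ℝ := fun σ ω =>
    Real.exp ((∑ i, FF (n * p) σ (col ω i)
      - (32 * n * (n * p) ^ 2 + 2 * m * (n * p))) / (16 * (n * p) ^ 2)) with hex
  have hex0 : ∀ σ ω, 0 ≤ ex σ ω := fun σ ω => (Real.exp_pos _).le
  have hRR0 : ∀ ω : Fin n → Fin m → Bool, 0 ≤ RR (n * p) ω := fun ω =>
    Finset.sum_nonneg fun _ _ => sq_nonneg _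
  have hD10 : ∀ ω : Fin n → Fin m → Bool, 0 ≤ D1 ω := fun ω =>
    Finset.sum_nonneg fun _ _ => Finset.sum_nonneg fun _ _ => bv_nonneg _
  have hD20 : ∀ ω : Fin n → Fin m → Bool, 0 ≤ D2 ω := fun ω => by
    refine Finset.sum_nonneg fun _ _ => Finset.sum_nonneg fun _ _ => ?_
    split_ifs
    · exact le_rfl
    · refine Finset.sum_nonneg fun _ _ => Finset.sum_nonneg fun _ _ => ?_
      split_ifs
      · exact le_rfl
      · exact mul_nonneg (mul_nonneg (bv_nonneg _) (bv_nonneg _))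
          (mul_nonneg (bv_nonneg _) (bv_nonneg _))
  have hpt : ∀ ω : Fin n → Fin m → Bool, (1:ℝ) ≤ (if ω ∈ S then 1 else 0) +
      ((1 / (M * s)) * RR (n * p) ω + ((1 / (M * s)) * D1 ω + ((1 / (M * y)) * D2 ω
        + ∑ σ, ex σ ω))) := by
    intro ω
    have t1 : 0 ≤ (1 / (M * s)) * RR (n * p) ω := mul_nonneg (by positivity) (hRR0 ω)
    have t2 : 0 ≤ (1 / (M * s)) * D1 ω := mul_nonneg (by positivity) (hD10 ω)
    have t3 : 0 ≤ (1 / (M * y)) * D2 ω := mul_nonneg (by positivity) (hD20 ω)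
    have t4 : 0 ≤ ∑ σ, ex σ ω := Finset.sum_nonneg fun σ _ => hex0 σ ω
    by_cases hω : ω ∈ S
    · rw [if_pos hω]; linarith
    rw [if_neg hω]
    by_contra hcon
    push Not at hcon
    apply hω
    have mk : ∀ a b : ℝ, 0 < a → (1 / a) * b < 1 → b ≤ a := by
      intro a b ha hb
      rw [one_div, inv_mul_lt_iff₀ ha] at hb
      linarith
    refine (good_det ω hm (n * p) s y hμ hs0.le hy0.le hs hy (mk _ _ (by positivity) (by linarith))
      (mk _ _ (by positivity) (by linarith)) (mk _ _ (by positivity) (by linarith)) ?_).trans hB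
    intro σ
    have h5 : ex σ ω ≤ ∑ σ, ex σ ω :=
      Finset.single_le_sum (fun σ _ => hex0 σ ω) (Finset.mem_univ σ)
    have h6 : ex σ ω < 1 := by linarith
    rw [hex, Real.exp_lt_one_iff, div_lt_iff₀ (by positivity)] at h6
    linarith
  have hE := EE_mono h0.le h1 hpt
  rw [EE_one, EE_add, EE_add, EE_add, EE_add, EE_mul, EE_mul, EE_mul, EE_sum, EE_D1] at hE
  have b1 : (1 / (M * s)) * EE p (fun ω : Fin n → Fin m → Bool => RR (n * p) ω)
      ≤ 1 / (n * p * s) := by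
    calc _ ≤ (1 / (M * s)) * (m * (n * p)) := by
          have := EE_RR (n := n) (m := m) h0.le
          gcongr
      _ = 1 / (n * p * s) := by rw [hM]; field_simp
  have b2 : (1 / (M * s)) * (m * (n * p)) = 1 / (n * p * s) := by rw [hM]; field_simp
  have b3 : (1 / (M * y)) * EE p (fun ω : Fin n → Fin m → Bool => D2 ω) ≤ m * p ^ 2 / y := by
    calc _ ≤ (1 / (M * y)) * (n ^ 2 * m ^ 2 * p ^ 4) := by
          have := EE_D2 (n := n) (m := m) (p := p)
          gcongr
      _ = m * p ^ 2 / y := by rw [hM]; field_simp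
  have b4 : ∑ σ, EE p (ex σ) ≤ Real.exp (-n) := by
    calc _ ≤ ∑ σ : Fin n → Bool, Real.exp (-(2 * n)) :=
          Finset.sum_le_sum fun σ _ => EE_exp h0.le h1 hμ σ
      _ = 2 ^ n * Real.exp (-(2 * n)) := by simp
      _ ≤ Real.exp n * Real.exp (-(2 * n)) := by
          gcongr
          have : (2:ℝ) ≤ Real.exp 1 := by linarith [Real.add_one_le_exp (1:ℝ)]
          calc (2:ℝ) ^ n ≤ Real.exp 1 ^ n := by gcongr
            _ = Real.exp n := by rw [← Real.exp_nat_mul, mul_one]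
      _ = Real.exp (-n) := by rw [← Real.exp_add]; congr 1; ring
  have b5 : 2 / (n * p * s) = 1 / (n * p * s) + 1 / (n * p * s) := by ring
  linarith

lemma rig_le_one {n m : ℕ} {p : ℝ} (h0 : 0 ≤ p) (h1 : p ≤ 1) (S : Set (Fin n → Fin m → Bool)) :
    rigMeasure n m p S ≤ 1 := by
  rw [rig_real h0 h1, ENNReal.ofReal_le_one]
  refine (EE_mono (g := fun _ => 1) h0 h1 fun ω => ?_).trans EE_one.le
  split_ifs <;> norm_num

/-- Theorem 2 (Thm:Large_np_mp): if `m p² = o(1)`, `n² m p² → ∞`, `n = o(m)` and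
`n p / ln(m/n) → ∞`, then for any `ω_n → ∞` there is a constant `C` such that with
high probability
`mod(G(n,m,p)) ≤ C ( (ln(m/n)/(np))^{1/2} + n/m + ω_n m p² )`. -/
theorem modularity_upper_bound_large_np_mp (m : ℕ → ℕ) (p : ℕ → ℝ)
    (hp : ∀ n, 0 ≤ p n ∧ p n ≤ 1)
    (h1 : Tendsto (fun n : ℕ => (m n : ℝ) * p n ^ 2) atTop (nhds 0))
    (h2 : Tendsto (fun n : ℕ => (n : ℝ) ^ 2 * (m n : ℝ) * p n ^ 2) atTop atTop)
    (h3 : Tendsto (fun n : ℕ => (n : ℝ) / (m n : ℝ)) atTop (nhds 0))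
    (h4 : Tendsto (fun n : ℕ => (n : ℝ) * p n / Real.log ((m n : ℝ) / (n : ℝ)))
      atTop atTop) :
    ∀ w : ℕ → ℝ, Tendsto w atTop atTop →
      ∃ C : ℝ,
        Tendsto (fun n : ℕ => rigMeasure n (m n) (p n)
            {ω | modularity (rigGraph ω) ≤
              C * (Real.sqrt (Real.log ((m n : ℝ) / (n : ℝ)) / ((n : ℝ) * p n)) +
                (n : ℝ) / (m n : ℝ) + w n * ((m n : ℝ) * p n ^ 2))})
          atTop (nhds 1) := by
  intro w hw
  refine ⟨1000, ?_⟩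
  set L : ℕ → ℝ := fun n => Real.log ((m n : ℝ) / (n : ℝ)) with hL
  have hpos : ∀ᶠ n : ℕ in atTop, 0 < n ∧ 0 < m n ∧ 0 < p n := by
    filter_upwards [h2.eventually_gt_atTop 0] with n hn
    refine ⟨Nat.pos_of_ne_zero ?_, Nat.pos_of_ne_zero ?_, lt_of_le_of_ne (hp n).1 ?_⟩
    · rintro rfl; simp at hn
    · intro h; simp [h] at hn
    · intro h; simp [← h] at hn
  have hL1 : ∀ᶠ n : ℕ in atTop, 1 ≤ L n := by
    have h3' : Tendsto (fun n : ℕ => ((n : ℝ) / (m n : ℝ))⁻¹) atTop atTop := by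
      refine Tendsto.inv_tendsto_nhdsGT_zero ?_
      rw [tendsto_nhdsWithin_iff]
      refine ⟨h3, ?_⟩
      filter_upwards [hpos] with n ⟨hn, hm, _⟩
      have : (0:ℝ) < n := by exact_mod_cast hn
      have : (0:ℝ) < m n := by exact_mod_cast hm
      simp only [Set.mem_Ioi]
      positivity
    have := (Real.tendsto_log_atTop.comp h3').eventually_ge_atTop 1
    filter_upwards [this] with n hn
    simpa [hL, inv_div] using hn
  have hμ : Tendsto (fun n : ℕ => (n : ℝ) * p n) atTop atTop := by
    refine tendsto_atTop_mono' atTop ?_ h4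
    filter_upwards [hL1] with n hn
    exact div_le_self (mul_nonneg (Nat.cast_nonneg _) (hp n).1) hn
  have hs : Tendsto (fun n : ℕ => Real.sqrt (L n / ((n : ℝ) * p n))) atTop (nhds 0) := by
    have := (Real.continuous_sqrt.tendsto 0).comp (tendsto_inv_atTop_zero.comp h4)
    rw [Real.sqrt_zero] at this
    refine this.congr fun n => ?_
    simp [Function.comp, hL, inv_div]
  have hδ : Tendsto (fun n : ℕ => ENNReal.ofReal (1 - (2 / Real.sqrt ((n : ℝ) * p n) +
      (1 / w n + 16 * ((m n : ℝ) * p n ^ 2)) + Real.exp (-(n : ℝ))))) atTop (nhds 1) := by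
    have t1 : Tendsto (fun n : ℕ => 2 / Real.sqrt ((n : ℝ) * p n)) atTop (nhds 0) :=
      Tendsto.const_div_atTop (Real.tendsto_sqrt_atTop.comp hμ) 2
    have t2 : Tendsto (fun n : ℕ => 1 / w n) atTop (nhds 0) := Tendsto.const_div_atTop hw 1
    have t3 : Tendsto (fun n : ℕ => Real.exp (-(n : ℝ))) atTop (nhds 0) :=
      Real.tendsto_exp_neg_atTop_nhds_zero.comp tendsto_natCast_atTop_atTop
    have t4 := ((t1.add (t2.add (h1.const_mul 16))).add t3).const_sub 1
    have t5 := ENNReal.tendsto_ofReal t4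
    simpa using t5
  refine tendsto_of_tendsto_of_tendsto_of_le_of_le' hδ tendsto_const_nhds ?_
    (Eventually.of_forall fun n => rig_le_one (hp n).1 (hp n).2 _)
  filter_upwards [hpos, hL1, hμ.eventually_ge_atTop 1, hs.eventually_le_const
    (by norm_num : (0:ℝ) < 1 / 16), hw.eventually_gt_atTop 0] with n ⟨hn, hm, hpn⟩ hLn hμn hsn hwn
  have hn' : (0:ℝ) < n := by exact_mod_cast hn
  have hm' : (0:ℝ) < m n := by exact_mod_cast hm
  set s : ℝ := Real.sqrt (L n / ((n : ℝ) * p n)) with hsdef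
  set q : ℝ := (m n : ℝ) * p n ^ 2 with hq
  have hq0 : 0 < q := by positivity
  set μ : ℝ := (n : ℝ) * p n with hμd
  have hμ0 : 0 < μ := by linarith
  have hsμ : 1 / Real.sqrt μ ≤ s := by
    rw [hsdef, Real.sqrt_div (by linarith)]
    gcongr
    exact Real.one_le_sqrt.2 hLn
  have hsq0 : 0 < Real.sqrt μ := Real.sqrt_pos.2 hμ0
  have hs0 : 0 < s := lt_of_lt_of_le (by positivity) hsμ
  have hsq1 : 1 ≤ Real.sqrt μ := Real.one_le_sqrt.2 hμn
  have hsqq : Real.sqrt μ * Real.sqrt μ = μ := Real.mul_self_sqrt hμ0.le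
  have hμs : Real.sqrt μ ≤ μ * s := by
    calc Real.sqrt μ = μ * (1 / Real.sqrt μ) := by
          nth_rewrite 2 [← hsqq]; field_simp
      _ ≤ μ * s := by gcongr
  have hinv : 1 / μ ≤ s := by
    refine le_trans ?_ hsμ
    apply one_div_le_one_div_of_le hsq0
    nlinarith
  set w' : ℝ := min (w n) (1 / (16 * q)) with hw'
  have hw'0 : 0 < w' := lt_min hwn (by positivity)
  have hyle : w' * q ≤ 1 / 16 := by
    calc w' * q ≤ 1 / (16 * q) * q := by gcongr; exact min_le_right _ _
      _ = 1 / 16 := by field_simp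
  have hyw : w' * q ≤ w n * q := by gcongr; exact min_le_left _ _
  have hqy : q / (w' * q) ≤ 1 / w n + 16 * q := by
    have : q / (w' * q) = 1 / w' := by field_simp
    rw [this]
    rcases min_choice (w n) (1 / (16 * q)) with h | h
    · rw [hw', h]; linarith
    · rw [hw', h, one_div_one_div]
      have : 0 < 1 / w n := by positivity
      linarith
  refine le_trans (ENNReal.ofReal_le_ofReal ?_) (prob_bound hn hm hpn (hp n).2 s (w' * q) _ hs0
    (by positivity) hsn hyle ?_)
  · have : 2 / (μ * s) ≤ 2 / Real.sqrt μ := by gcongr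
    linarith
  · have e1 : 16 / μ = 16 * (1 / μ) := by ring
    rw [← hμd, e1]
    have : (0:ℝ) ≤ (n:ℝ) / m n := by positivity
    have : 0 < w n * q := by positivity
    linarith

end RIG
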